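/- Let Λ, μ, a, b, r, γ be positive constants and let β, η, c, θ : [0,∞) → ℝ be bounded, nonnegative and continuous with c^ℓ := inf_{t≥0} c(t) > 0. Let (S,I,P) : [t₀,∞) → ℝ³ be a solution with nonnegative components of the system S' = (Λ − μS)S − aSP − β(t)SI, I' = β(t)SI − η(t)PI − c(t)I, P' = (b − rP)P + γaSP + θ(t)η(t)PI, with positive initial conditions. Then limsup_{t→∞}(S(t) + I(t)) ≤ A := (1/c^ℓ)(Λ²/(4μ) + c^u Λ/μ) and limsup_{t→∞} P(t) ≤ B := (1/r)(b + γaA + θ^u η^u A), where f^u := sup_{t≥0} f(t). In particular the region {(S,I,P) ∈ ℝ³ : 0 ≤ S + I ≤ A and 0 ≤ P ≤ B} contains the ω-limit set of every such solution. -/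

import Mathlib

open Filter MeasureTheory Set

lemma eventually_le_of_deriv_neg (f f' : ℝ → ℝ) (T M δ : ℝ) (hδ : 0 < δ)
    (hf : ∀ t ≥ T, HasDerivAt f (f' t) t)
    (hneg : ∀ t ≥ T, M ≤ f t → f' t ≤ -δ) : ∀ᶠ t in atTop, f t ≤ M := by
  have h1 : ∃ t1 ≥ T, f t1 ≤ M := by
    by_contra! hcon
    have hlin : ∀ t ≥ T, f t ≤ f T - δ * (t - T) := by
      intro t ht
      have := image_le_of_deriv_right_le_deriv_boundary (f := f) (f' := f') (a := T) (b := t)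
        (B := fun x => f T - δ * (x - T)) (B' := fun _ => -δ)
        (fun x hx => (hf x hx.1).continuousAt.continuousWithinAt)
        (fun x hx => (hf x hx.1).hasDerivWithinAt) (by simp)
        (by fun_prop)
        (fun x hx => by
          have h := ((((hasDerivAt_id x).sub_const T).const_mul δ).const_sub (f T))
          simpa using h.hasDerivWithinAt)
        (fun x hx => hneg x hx.1 (hcon x hx.1).le)
      exact this ⟨ht, le_rfl⟩
    have hM := hcon T le_rfl
    have hq : 0 ≤ (f T - M) / δ := div_nonneg (by linarith) hδ.le
    have h2 := hlin (T + (f T - M) / δ) (by linarith)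
    have h3 := hcon (T + (f T - M) / δ) (by linarith)
    have h4 : δ * (T + (f T - M) / δ - T) = f T - M := by field_simp; ring
    linarith
  obtain ⟨t1, ht1, hft⟩ := h1
  filter_upwards [eventually_ge_atTop t1] with t ht
  exact image_le_of_deriv_right_lt_deriv_boundary (f := f) (f' := f') (a := t1) (b := t)
    (B := fun _ => M) (B' := fun _ => 0)
    (fun x hx => (hf x (ht1.le.trans hx.1)).continuousAt.continuousWithinAt)
    (fun x hx => (hf x (ht1.le.trans hx.1)).hasDerivWithinAt) hft
    (fun x => hasDerivAt_const x M)
    (fun x hx he => by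
      have := hneg x (ht1.le.trans hx.1) he.ge
      linarith) ⟨ht, le_rfl⟩

lemma limsup_le_of_eps (f : ℝ → ℝ) (L : ℝ) (h0 : ∀ᶠ t in atTop, 0 ≤ f t)
    (h : ∀ ε > 0, ∀ᶠ t in atTop, f t ≤ L + ε) : limsup f atTop ≤ L := by
  refine le_of_forall_pos_le_add fun ε hε => ?_
  exact limsup_le_of_le (IsBoundedUnder.isCoboundedUnder_le ⟨0, by simpa using h0⟩) (h ε hε)

/-- STATEMENT 8: boundedness lemma for the eco-epidemiological model with logistic prey
growth `G(t,S) = (Λ − μS)S`, bilinear predation `f(S,I,P) = S`, `g(S,I,P) = P` and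
predator vital dynamics `h(t,P) = b − rP`. -/
theorem stmt_8
    (Λ μ a b r γ : ℝ)
    (hΛ : 0 < Λ) (hμ : 0 < μ) (ha : 0 < a) (hb : 0 < b) (hr : 0 < r) (hγ : 0 < γ)
    (β η c θ : ℝ → ℝ)
    (hβ : ContinuousOn β (Ici 0) ∧ (∀ t ≥ (0:ℝ), 0 ≤ β t) ∧ ∃ M, ∀ t ≥ (0:ℝ), |β t| ≤ M)
    (hη : ContinuousOn η (Ici 0) ∧ (∀ t ≥ (0:ℝ), 0 ≤ η t) ∧ ∃ M, ∀ t ≥ (0:ℝ), |η t| ≤ M)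
    (hc : ContinuousOn c (Ici 0) ∧ (∀ t ≥ (0:ℝ), 0 ≤ c t) ∧ ∃ M, ∀ t ≥ (0:ℝ), |c t| ≤ M)
    (hθ : ContinuousOn θ (Ici 0) ∧ (∀ t ≥ (0:ℝ), 0 ≤ θ t) ∧ ∃ M, ∀ t ≥ (0:ℝ), |θ t| ≤ M)
    (hcl : 0 < sInf (c '' Ici 0))
    (t₀ : ℝ) (ht₀ : 0 ≤ t₀)
    (S I P : ℝ → ℝ)
    (hS : ∀ t ≥ t₀, HasDerivAt S
      ((Λ - μ * S t) * S t - a * S t * P t - β t * S t * I t) t)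
    (hI : ∀ t ≥ t₀, HasDerivAt I
      (β t * S t * I t - η t * P t * I t - c t * I t) t)
    (hP : ∀ t ≥ t₀, HasDerivAt P
      ((b - r * P t) * P t + γ * a * S t * P t + θ t * η t * P t * I t) t)
    (hnn : ∀ t ≥ t₀, 0 ≤ S t ∧ 0 ≤ I t ∧ 0 ≤ P t)
    (hinit : 0 < S t₀ ∧ 0 < I t₀ ∧ 0 < P t₀) :
    limsup (fun t => S t + I t) atTop ≤
      (1 / sInf (c '' Ici 0)) * (Λ ^ 2 / (4 * μ) + sSup (c '' Ici 0) * Λ / μ) ∧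
    limsup P atTop ≤
      (1 / r) * (b + γ * a *
        ((1 / sInf (c '' Ici 0)) * (Λ ^ 2 / (4 * μ) + sSup (c '' Ici 0) * Λ / μ)) +
        sSup (θ '' Ici 0) * sSup (η '' Ici 0) *
        ((1 / sInf (c '' Ici 0)) * (Λ ^ 2 / (4 * μ) + sSup (c '' Ici 0) * Λ / μ))) := by
  obtain ⟨-, hβ0, -⟩ := hβ
  obtain ⟨-, hη0, Mη, hMη⟩ := hη
  obtain ⟨-, hc0, Mc, hMc⟩ := hc
  obtain ⟨-, hθ0, Mθ, hMθ⟩ := hθ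
  have bdd : ∀ (f : ℝ → ℝ) (M : ℝ), (∀ t ≥ (0:ℝ), |f t| ≤ M) →
      ∀ t ≥ (0:ℝ), f t ≤ sSup (f '' Ici 0) := by
    intro f M hM t ht
    refine le_csSup ⟨M, ?_⟩ ⟨t, ht, rfl⟩
    rintro _ ⟨s, hs, rfl⟩
    exact (le_abs_self _).trans (hM s hs)
  have hcu := bdd c Mc hMc
  have hηu := bdd η Mη hMη
  have hθu := bdd θ Mθ hMθ
  have hcl' : ∀ t ≥ (0:ℝ), sInf (c '' Ici 0) ≤ c t := by
    intro t ht
    refine csInf_le ⟨0, ?_⟩ ⟨t, ht, rfl⟩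
    rintro _ ⟨s, hs, rfl⟩
    exact hc0 s hs
  generalize sInf (c '' Ici 0) = cl at *
  generalize sSup (c '' Ici 0) = cu at *
  generalize sSup (η '' Ici 0) = ηu at *
  generalize sSup (θ '' Ici 0) = θu at *
  have hcu0 : 0 ≤ cu := (hc0 0 le_rfl).trans (hcu 0 le_rfl)
  have hηu0 : 0 ≤ ηu := (hη0 0 le_rfl).trans (hηu 0 le_rfl)
  have hθu0 : 0 ≤ θu := (hθ0 0 le_rfl).trans (hθu 0 le_rfl)
  obtain ⟨A, hA⟩ : ∃ A, A = (1 / cl) * (Λ ^ 2 / (4 * μ) + cu * Λ / μ) := ⟨_, rfl⟩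
  rw [← hA]
  have hA0 : 0 ≤ A := by rw [hA]; positivity
  have hclA : cl * A = Λ ^ 2 / (4 * μ) + cu * (Λ / μ) := by rw [hA]; field_simp
  obtain ⟨B, hB⟩ : ∃ B, B = (1 / r) * (b + γ * a * A + θu * ηu * A) := ⟨_, rfl⟩
  rw [← hB]
  have hB0 : 0 ≤ B := by rw [hB]; positivity
  have hrB : r * B = b + γ * a * A + θu * ηu * A := by rw [hB]; field_simp
  -- bound on S
  have hSev : ∀ ε > 0, ∀ᶠ t in atTop, S t ≤ Λ / μ + ε := by
    intro ε hε
    refine eventually_le_of_deriv_neg S _ t₀ _ (μ * ε * (Λ / μ)) (by positivity) hS ?_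
    intro t ht hM
    obtain ⟨h1, h2, h3⟩ := hnn t ht
    have e1 : 0 ≤ a * S t * P t := by positivity
    have e2 : 0 ≤ β t * S t * I t := by have := hβ0 t (ht₀.trans ht); positivity
    have e3 : μ * (Λ / μ) = Λ := by field_simp
    have e4 : μ * (Λ / μ + ε) ≤ μ * S t := by gcongr
    have e5 : 0 < Λ / μ := by positivity
    have e6 : Λ / μ ≤ S t := by linarith
    have e7 : μ * ε * (Λ / μ) ≤ (μ * S t - Λ) * S t := by
      apply mul_le_mul _ e6 e5.le <;> nlinarith
    linarith
  have hNev : ∀ ε > 0, ∀ᶠ t in atTop, S t + I t ≤ A + ε := by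
    intro ε hε
    obtain ⟨ε', hε', hlt⟩ : ∃ ε' > 0, cu * ε' ≤ cl * ε / 2 := by
      refine ⟨cl * ε / (2 * (cu + 1)), by positivity, ?_⟩
      rw [← mul_div_assoc, div_le_div_iff₀ (by positivity) (by positivity)]
      nlinarith [mul_pos hcl hε]
    obtain ⟨T, hT⟩ := eventually_atTop.1 (hSev ε' hε')
    refine eventually_le_of_deriv_neg (fun t => S t + I t) _ (max T t₀) _ (cl * ε / 2)
      (by positivity)
      (fun t ht => (hS t (le_of_max_le_right ht)).add (hI t (le_of_max_le_right ht))) ?_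
    intro t ht hM
    have ht2 := le_of_max_le_right ht
    have hSt := hT t (le_of_max_le_left ht)
    have ht3 := ht₀.trans ht2
    obtain ⟨h1, h2, h3⟩ := hnn t ht2
    have e1 : 0 ≤ a * S t * P t := by positivity
    have e2 : 0 ≤ η t * P t * I t := by have := hη0 t ht3; positivity
    have e3 : (Λ - μ * S t) * S t ≤ Λ ^ 2 / (4 * μ) := by
      rw [le_div_iff₀ (by positivity)]
      nlinarith [sq_nonneg (Λ - 2 * μ * S t)]
    have e4 : c t * S t ≤ cu * (Λ / μ + ε') := mul_le_mul (hcu t ht3) hSt h1 hcu0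
    have e5 : cl * (A + ε) ≤ c t * (S t + I t) :=
      mul_le_mul (hcl' t ht3) hM (by positivity) (hc0 t ht3)
    linarith
  have hPev : ∀ ε > 0, ∀ᶠ t in atTop, P t ≤ B + ε := by
    intro ε hε
    obtain ⟨ε', hε', hlt⟩ : ∃ ε' > 0, (γ * a + θu * ηu) * ε' ≤ r * ε / 2 := by
      refine ⟨r * ε / (2 * (γ * a + θu * ηu)), by positivity, ?_⟩
      apply le_of_eq
      field_simp
    obtain ⟨T, hT⟩ := eventually_atTop.1 (hNev ε' hε')
    refine eventually_le_of_deriv_neg P _ (max T t₀) _ (r * ε / 2 * ε)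
      (by positivity) (fun t ht => hP t (le_of_max_le_right ht)) ?_
    intro t ht hM
    have ht2 := le_of_max_le_right ht
    have hNt := hT t (le_of_max_le_left ht)
    have ht3 := ht₀.trans ht2
    obtain ⟨h1, h2, h3⟩ := hnn t ht2
    have e1 : γ * a * S t ≤ γ * a * (A + ε') := by gcongr; linarith
    have e2 : θ t * η t ≤ θu * ηu := mul_le_mul (hθu t ht3) (hηu t ht3) (hη0 t ht3) hθu0
    have e3 : θ t * η t * I t ≤ θu * ηu * (A + ε') :=
      mul_le_mul e2 (by linarith) h2 (by positivity)
    have e4 : r * (B + ε) ≤ r * P t := by gcongr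
    have e5 : r * ε / 2 ≤ -(b - r * P t + γ * a * S t + θ t * η t * I t) := by linarith
    have e6 : r * ε / 2 * ε ≤ -(b - r * P t + γ * a * S t + θ t * η t * I t) * P t :=
      mul_le_mul e5 (by linarith) hε.le (le_trans (by positivity) e5)
    linarith
  constructor
  · refine limsup_le_of_eps _ _ ?_ hNev
    filter_upwards [eventually_ge_atTop t₀] with t ht
    exact add_nonneg (hnn t ht).1 (hnn t ht).2.1
  · refine limsup_le_of_eps _ _ ?_ hPev
    filter_upwards [eventually_ge_atTop t₀] with t ht
    exact (hnn t ht).2.2
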